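/- arXiv:1909.06293 — 3 statements merged into one kernel-verified Lean document; each statement's English description precedes it below -/
import Mathlib

section
/- Assume the actions are ordered so that 0 < ℓ_1 < ℓ_2 < … < ℓ_A. Then for every policy π, the Kullback–Leibler divergence D(π) between the mixture density u_π and the uniform density u• is given by the closed form D(π) = Σ_{n=1}^{A} (ℓ_n − ℓ_{n−1}) · (Σ_{k=n}^{A} π_k/ℓ_k) · log(Σ_{b=n}^{A} π_b ℓ_A/ℓ_b), where ℓ_0 = 0 and a summand with Σ_{k=n}^{A} π_k = 0 is taken to be 0. -/
open MeasureTheory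

/-- Mixture density `u_π(x) = Σ_{k=1}^A (π_k/(2ℓ_k)) · 1_{[−ℓ_k, ℓ_k]}(x)`. -/
noncomputable def uMix (A : ℕ) (ℓ : ℕ → ℝ) (π : ℕ → ℝ) (x : ℝ) : ℝ :=
  ∑ k ∈ Finset.Icc 1 A,
    (π k / (2 * ℓ k)) * Set.indicator (Set.Icc (-ℓ k) (ℓ k)) (fun _ => (1 : ℝ)) x

/-- Uniform density `u•(x) = (1/(2ℓ_A)) · 1_{[−ℓ_A, ℓ_A]}(x)`. -/
noncomputable def uUnif (A : ℕ) (ℓ : ℕ → ℝ) (x : ℝ) : ℝ :=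
  (1 / (2 * ℓ A)) * Set.indicator (Set.Icc (-ℓ A) (ℓ A)) (fun _ => (1 : ℝ)) x

/-- Kullback–Leibler divergence `D(π) = ∫ u_π log(u_π/u•)`; the convention
`0 · log 0 = 0` is automatic since `Real.log 0 = 0` in Lean. -/
noncomputable def KLdiv (A : ℕ) (ℓ : ℕ → ℝ) (π : ℕ → ℝ) : ℝ :=
  ∫ x : ℝ, uMix A ℓ π x * Real.log (uMix A ℓ π x / uUnif A ℓ x)

/-- A policy on actions `{1, …, A}`: nonnegative entries summing to one. -/
def IsPolicy (A : ℕ) (π : ℕ → ℝ) : Prop :=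
  (∀ k ∈ Finset.Icc 1 A, 0 ≤ π k) ∧ ∑ k ∈ Finset.Icc 1 A, π k = 1

/-- A sequence increasing at each step below `A` is monotone up to `A`. -/
theorem le_of_forall_lt_succ {A : ℕ} {ℓ : ℕ → ℝ} (h : ∀ n < A, ℓ n < ℓ (n + 1))
    {i j : ℕ} (hij : i ≤ j) (hj : j ≤ A) : ℓ i ≤ ℓ j := by
  induction j, hij using Nat.le_induction with
  | base => exact le_rfl
  | succ j _ ih => exact (ih (by omega)).trans (h j (by omega)).le

/-- The integrand of `KLdiv` is, off the origin, a step function whose value on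
`ℓ (n - 1) < |x| ≤ ℓ n` is explicit. -/
theorem uMix_mul_log_eq_sum {A : ℕ} {ℓ : ℕ → ℝ} (hℓ0 : ℓ 0 = 0)
    (hlt : ∀ n < A, ℓ n < ℓ (n + 1)) (hpos : 0 < ℓ A) (π : ℕ → ℝ) {x : ℝ} (hx : x ≠ 0) :
    uMix A ℓ π x * Real.log (uMix A ℓ π x / uUnif A ℓ x) =
      ∑ n ∈ Finset.Icc 1 A,
        ((Set.Icc (-ℓ n) (ℓ n)).indicator (fun _ => (1 : ℝ)) x -
          (Set.Icc (-ℓ (n - 1)) (ℓ (n - 1))).indicator (fun _ => (1 : ℝ)) x) *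
        ((1 / 2) * (∑ k ∈ Finset.Icc n A, π k / ℓ k) *
          Real.log (∑ b ∈ Finset.Icc n A, π b * ℓ A / ℓ b)) := by
  by_cases hxA : |x| ≤ ℓ A
  · have hex : ∃ n, |x| ≤ ℓ n := ⟨A, hxA⟩
    obtain ⟨m, hm, hmin⟩ : ∃ m, |x| ≤ ℓ m ∧ ∀ n < m, ¬ |x| ≤ ℓ n := by
      classical exact ⟨Nat.find hex, Nat.find_spec hex, fun n hn => Nat.find_min hex hn⟩
    have hmA : m ≤ A := by
      by_contra! h
      exact hmin A h hxA
    have hm1 : 1 ≤ m := by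
      rcases Nat.eq_zero_or_pos m with rfl | h
      · exact absurd hm (by simpa [hℓ0] using hx)
      · exact h
    have hind : ∀ n ≤ A, (Set.Icc (-ℓ n) (ℓ n)).indicator (fun _ => (1 : ℝ)) x =
        if m ≤ n then 1 else 0 := by
      intro n hn
      have hiff : x ∈ Set.Icc (-ℓ n) (ℓ n) ↔ m ≤ n := by
        rw [Set.mem_Icc, ← abs_le]
        refine ⟨fun h => ?_, fun h => hm.trans (le_of_forall_lt_succ hlt h hn)⟩
        by_contra! h'
        exact hmin n h' h
      simp [Set.indicator_apply, hiff]
    have hmix : uMix A ℓ π x = (1 / 2) * ∑ k ∈ Finset.Icc m A, π k / ℓ k := by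
      have hfilter : Finset.Icc m A = (Finset.Icc 1 A).filter (m ≤ ·) := by
        ext k
        simp only [Finset.mem_Icc, Finset.mem_filter]
        omega
      rw [uMix, hfilter, Finset.sum_filter, Finset.mul_sum]
      refine Finset.sum_congr rfl fun k hk => ?_
      rw [hind k (Finset.mem_Icc.1 hk).2]
      split_ifs <;> ring
    have hratio : uMix A ℓ π x / uUnif A ℓ x = ∑ b ∈ Finset.Icc m A, π b * ℓ A / ℓ b := by
      rw [hmix, uUnif, hind A le_rfl, if_pos hmA]
      have : ∑ b ∈ Finset.Icc m A, π b * ℓ A / ℓ b =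
          ℓ A * ∑ k ∈ Finset.Icc m A, π k / ℓ k := by
        rw [Finset.mul_sum]
        exact Finset.sum_congr rfl fun b _ => by ring
      rw [this]
      field_simp
    rw [hratio, hmix]
    refine ((Finset.sum_eq_single m ?_ ?_).trans ?_).symm
    · intro n hn hne
      have := Finset.mem_Icc.1 hn
      rw [hind n this.2, hind (n - 1) (by omega)]
      by_cases h : m ≤ n
      · rw [if_pos h, if_pos (by omega)]
        ring
      · rw [if_neg h, if_neg (by omega)]
        ring
    · intro h
      exact absurd (Finset.mem_Icc.2 ⟨hm1, hmA⟩) h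
    · rw [hind m hmA, hind (m - 1) (by omega), if_pos le_rfl, if_neg (by omega)]
      ring
  · have hind : ∀ n ≤ A, (Set.Icc (-ℓ n) (ℓ n)).indicator (fun _ => (1 : ℝ)) x = 0 := by
      intro n hn
      refine Set.indicator_of_notMem (fun h => hxA ?_) _
      exact (abs_le.2 h).trans (le_of_forall_lt_succ hlt hn le_rfl)
    have hmix : uMix A ℓ π x = 0 :=
      Finset.sum_eq_zero fun k hk => by rw [hind k (Finset.mem_Icc.1 hk).2, mul_zero]
    rw [hmix, zero_mul]
    refine (Finset.sum_eq_zero fun n hn => ?_).symm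
    have := (Finset.mem_Icc.1 hn).2
    rw [hind n this, hind (n - 1) (by omega), sub_zero, zero_mul]

/-- The indicator of a compact interval is integrable. -/
theorem integrable_indicator_Icc_one (a b : ℝ) :
    Integrable ((Set.Icc a b).indicator fun _ => (1 : ℝ)) :=
  (integrable_indicator_iff measurableSet_Icc).2 (integrableOn_const (by simp))

/-- The integral of the indicator of `[-a, a]` is `2 * a`. -/
theorem integral_indicator_Icc_neg_self {a : ℝ} (ha : 0 ≤ a) :
    ∫ x, (Set.Icc (-a) a).indicator (fun _ => (1 : ℝ)) x = 2 * a := by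
  rw [integral_indicator measurableSet_Icc, setIntegral_const, smul_eq_mul, mul_one,
    Real.volume_real_Icc_of_le (by linarith)]
  ring

/-- closed form for the KL divergence, with `ℓ_0 = 0`.  A summand
with `Σ_{k=n}^A π_k = 0` is automatically `0` (its factor `Σ π_k/ℓ_k` vanishes). -/
theorem kl_closed_form (A : ℕ) (hA : 1 ≤ A) (ℓ : ℕ → ℝ)
    (hℓ0 : ℓ 0 = 0) (hℓ1 : 0 < ℓ 1)
    (hmono : ∀ n, 1 ≤ n → n < A → ℓ n < ℓ (n + 1))
    (π : ℕ → ℝ) (hπ : IsPolicy A π) :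
    KLdiv A ℓ π =
      ∑ n ∈ Finset.Icc 1 A,
        (ℓ n - ℓ (n - 1)) * (∑ k ∈ Finset.Icc n A, π k / ℓ k) *
          Real.log (∑ b ∈ Finset.Icc n A, π b * ℓ A / ℓ b) := by
  have hlt : ∀ n < A, ℓ n < ℓ (n + 1) := by
    intro n hn
    rcases Nat.eq_zero_or_pos n with rfl | h
    · simpa [hℓ0] using hℓ1
    · exact hmono n h hn
  have hnonneg : ∀ n ≤ A, 0 ≤ ℓ n := fun n hn =>
    hℓ0.symm.le.trans (le_of_forall_lt_succ hlt n.zero_le hn)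
  have hpos : 0 < ℓ A := hℓ1.trans_le (le_of_forall_lt_succ hlt hA le_rfl)
  have hae : ∀ᵐ x : ℝ, x ≠ 0 := by simp [ae_iff]
  rw [KLdiv, integral_congr_ae (hae.mono fun x hx => uMix_mul_log_eq_sum hℓ0 hlt hpos π hx),
    integral_finsetSum]
  · refine Finset.sum_congr rfl fun n hn => ?_
    have hnA := (Finset.mem_Icc.1 hn).2
    rw [integral_mul_const, integral_sub (integrable_indicator_Icc_one _ _)
      (integrable_indicator_Icc_one _ _), integral_indicator_Icc_neg_self (hnonneg n hnA),
      integral_indicator_Icc_neg_self (hnonneg (n - 1) (by omega))]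
    ring
  · intro n _
    exact ((integrable_indicator_Icc_one _ _).sub (integrable_indicator_Icc_one _ _)).mul_const _
end

section
/- If action j ∈ {1,…,A} is Pareto dominated, then every policy π that maximizes f over the set of policies satisfies π_j = 0. -/
open MeasureTheory

/-- The objective `f(π) = Σ_k π_k q_k − κ D(π)`. -/
noncomputable def objective (A : ℕ) (ℓ q : ℕ → ℝ) (κ : ℝ) (π : ℕ → ℝ) : ℝ :=
  (∑ k ∈ Finset.Icc 1 A, π k * q k) - κ * KLdiv A ℓ π

/-- Action `j` is Pareto dominated: some action `i` has `q_j ≤ q_i` and `ℓ_j < ℓ_i`. -/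
def ParetoDominated (A : ℕ) (ℓ q : ℕ → ℝ) (j : ℕ) : Prop :=
  ∃ i ∈ Finset.Icc 1 A, q j ≤ q i ∧ ℓ j < ℓ i

/-- Action `k` is mixed Pareto dominated. -/
def MixedParetoDominated (A : ℕ) (ℓ q : ℕ → ℝ) (k : ℕ) : Prop :=
  ∃ i ∈ Finset.Icc 1 A, ∃ j ∈ Finset.Icc 1 A,
    ℓ i > ℓ k ∧ ℓ k > ℓ j ∧
    1 < ((ℓ i - ℓ k) * ℓ j * q j + (ℓ k - ℓ j) * ℓ i * q i) / ((ℓ i - ℓ j) * ℓ k * q k)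

/-- An action is Pareto optimal if it is neither Pareto dominated nor mixed
Pareto dominated. -/
def ParetoOptimal (A : ℕ) (ℓ q : ℕ → ℝ) (a : ℕ) : Prop :=
  ¬ ParetoDominated A ℓ q a ∧ ¬ MixedParetoDominated A ℓ q a

theorem mul_log_mul_tangent_lt {s t K : ℝ} (hs : 0 < s) (ht : 0 ≤ t) (hK : 0 < K) (hne : t ≠ s) :
    (t - s) * (Real.log (s * K) + 1) < t * Real.log (t * K) - s * Real.log (s * K) := by
  rcases ht.eq_or_lt with rfl | ht
  · simp only [zero_mul]
    nlinarith
  · have hst : s / t ≠ 1 := fun h => hne ((div_eq_one_iff_eq ht.ne').1 h).symm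
    have h := Real.log_lt_sub_one_of_pos (div_pos hs ht) hst
    rw [Real.log_div hs.ne' ht.ne'] at h
    have h' := mul_lt_mul_of_pos_left h ht
    have e : t * (s / t - 1) = s - t := by field_simp
    rw [e] at h'
    rw [Real.log_mul hs.ne' hK.ne', Real.log_mul ht.ne' hK.ne']
    nlinarith

section Density

variable {A : ℕ} {ℓ π : ℕ → ℝ}

theorem uMix_nonneg (hℓ : ∀ k ∈ Finset.Icc 1 A, 0 < ℓ k)
    (hπ : ∀ k ∈ Finset.Icc 1 A, 0 ≤ π k) (x : ℝ) : 0 ≤ uMix A ℓ π x :=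
  Finset.sum_nonneg fun k hk => mul_nonneg
    (div_nonneg (hπ k hk) (by linarith [hℓ k hk]))
    (Set.indicator_nonneg (fun _ _ => zero_le_one) x)

theorem uMix_anti (hℓ : ∀ k ∈ Finset.Icc 1 A, 0 < ℓ k)
    (hπ : ∀ k ∈ Finset.Icc 1 A, 0 ≤ π k) {x y : ℝ} (hxy : |x| ≤ |y|) :
    uMix A ℓ π y ≤ uMix A ℓ π x := by
  refine Finset.sum_le_sum fun k hk => mul_le_mul_of_nonneg_left ?_
    (div_nonneg (hπ k hk) (by linarith [hℓ k hk]))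
  by_cases hy : y ∈ Set.Icc (-ℓ k) (ℓ k)
  · have hx : x ∈ Set.Icc (-ℓ k) (ℓ k) := abs_le.1 (hxy.trans (abs_le.2 hy))
    simp [Set.indicator_of_mem hx, Set.indicator_of_mem hy]
  · rw [Set.indicator_of_notMem hy]
    exact Set.indicator_nonneg (fun _ _ => zero_le_one) x

theorem uMix_pos (hℓ : ∀ k ∈ Finset.Icc 1 A, 0 < ℓ k)
    (hπ : ∀ k ∈ Finset.Icc 1 A, 0 ≤ π k) {i : ℕ} (hi : i ∈ Finset.Icc 1 A) (hπi : 0 < π i)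
    {x : ℝ} (hx : x ∈ Set.Icc (-ℓ i) (ℓ i)) : 0 < uMix A ℓ π x := by
  refine Finset.sum_pos' (fun k hk => mul_nonneg
    (div_nonneg (hπ k hk) (by linarith [hℓ k hk]))
    (Set.indicator_nonneg (fun _ _ => zero_le_one) x)) ⟨i, hi, ?_⟩
  rw [Set.indicator_of_mem hx, mul_one]
  exact div_pos hπi (by linarith [hℓ i hi])

theorem uMix_eq_zero (hle : ∀ k ∈ Finset.Icc 1 A, ℓ k ≤ ℓ A) {x : ℝ}
    (hx : x ∉ Set.Icc (-ℓ A) (ℓ A)) : uMix A ℓ π x = 0 := by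
  refine Finset.sum_eq_zero fun k hk => ?_
  rw [Set.indicator_of_notMem, mul_zero]
  exact fun h => hx (Set.Icc_subset_Icc (neg_le_neg (hle k hk)) (hle k hk) h)

theorem measurable_uMix : Measurable (uMix A ℓ π) := by
  unfold uMix
  exact Finset.measurable_sum _ fun k _ =>
    (measurable_const.indicator measurableSet_Icc).const_mul _

theorem integrable_comp_uMix (hℓ : ∀ k ∈ Finset.Icc 1 A, 0 < ℓ k)
    (hle : ∀ k ∈ Finset.Icc 1 A, ℓ k ≤ ℓ A) (hπ : ∀ k ∈ Finset.Icc 1 A, 0 ≤ π k)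
    {h : ℝ → ℝ} (hc : Continuous h) (h0 : h 0 = 0) :
    Integrable (fun x => h (uMix A ℓ π x)) := by
  obtain ⟨C, hC⟩ := (isCompact_Icc (a := (0 : ℝ)) (b := uMix A ℓ π 0)).exists_bound_of_continuousOn
    hc.continuousOn
  rw [← integrableOn_iff_integrable_of_support_subset (s := Set.Icc (-ℓ A) (ℓ A))]
  · refine Measure.integrableOn_of_bounded (M := C) measure_Icc_lt_top.ne
      (hc.measurable.comp measurable_uMix).aestronglyMeasurable
      (Filter.Eventually.of_forall fun x => hC _ ⟨uMix_nonneg hℓ hπ x, uMix_anti hℓ hπ ?_⟩)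
    simp
  · intro x hx
    by_contra hxA
    exact hx (by simp only [uMix_eq_zero hle hxA, h0])

theorem KLdiv_eq (hle : ∀ k ∈ Finset.Icc 1 A, ℓ k ≤ ℓ A) :
    KLdiv A ℓ π = ∫ x, uMix A ℓ π x * Real.log (uMix A ℓ π x * (2 * ℓ A)) := by
  refine integral_congr_ae (Filter.Eventually.of_forall fun x => ?_)
  by_cases hx : x ∈ Set.Icc (-ℓ A) (ℓ A)
  · simp [uUnif, Set.indicator_of_mem hx, div_eq_mul_inv]
  · simp [uMix_eq_zero hle hx]

theorem continuous_mul_log_mul (K : ℝ) (hK : 0 < K) :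
    Continuous fun t : ℝ => t * Real.log (t * K) := by
  have h : (fun t : ℝ => t * Real.log (t * K)) = fun t => K⁻¹ * ((t * K) * Real.log (t * K)) := by
    funext t
    field_simp
  rw [h]
  exact (Real.continuous_mul_log.comp (continuous_mul_const K)).const_mul _

theorem sum_transfer {i j : ℕ} (hi : i ∈ Finset.Icc 1 A) (hj : j ∈ Finset.Icc 1 A) (m : ℝ)
    (g : ℕ → ℝ) :
    ∑ k ∈ Finset.Icc 1 A, (π k + (Pi.single i m : ℕ → ℝ) k - (Pi.single j m : ℕ → ℝ) k) * g k =
      ∑ k ∈ Finset.Icc 1 A, π k * g k + m * (g i - g j) := by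
  simp only [sub_mul, add_mul, Finset.sum_sub_distrib, Finset.sum_add_distrib]
  have h (a : ℕ) (ha : a ∈ Finset.Icc 1 A) :
      ∑ k ∈ Finset.Icc 1 A, (Pi.single a m : ℕ → ℝ) k * g k = m * g a := by
    rw [Finset.sum_eq_single_of_mem a ha]
    · simp
    · intro b _ hb
      simp [hb]
  rw [h i hi, h j hj]
  ring

theorem uMix_transfer {i j : ℕ} (hi : i ∈ Finset.Icc 1 A) (hj : j ∈ Finset.Icc 1 A) (m x : ℝ) :
    uMix A ℓ (π + Pi.single i m - Pi.single j m : ℕ → ℝ) x = uMix A ℓ π x +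
      m * ((Set.Icc (-ℓ i) (ℓ i)).indicator (fun _ => 1 / (2 * ℓ i)) x -
        (Set.Icc (-ℓ j) (ℓ j)).indicator (fun _ => 1 / (2 * ℓ j)) x) := by
  have h := sum_transfer (π := π) hi hj m fun k =>
    (Set.Icc (-ℓ k) (ℓ k)).indicator (fun _ => 1 / (2 * ℓ k)) x
  have e (a k : ℕ → ℝ) (n : ℕ) : a n / (2 * ℓ n) *
      (Set.Icc (-ℓ n) (ℓ n)).indicator (fun _ => (1 : ℝ)) x =
      a n * (Set.Icc (-ℓ n) (ℓ n)).indicator (fun _ => 1 / (2 * ℓ n)) x := by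
    by_cases hx : x ∈ Set.Icc (-ℓ n) (ℓ n)
    · simp [Set.indicator_of_mem hx, div_eq_mul_inv]
    · simp [Set.indicator_of_notMem hx]
  simp only [uMix, e _ π]
  exact h

theorem integral_uniform {r : ℝ} (hr : 0 < r) :
    ∫ x, (Set.Icc (-r) r).indicator (fun _ => 1 / (2 * r)) x = 1 := by
  rw [integral_indicator measurableSet_Icc, setIntegral_const]
  simp only [Measure.real, Real.volume_Icc, smul_eq_mul]
  rw [ENNReal.toReal_ofReal (by linarith)]
  field_simp
  ring

theorem integrable_uniform (r : ℝ) :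
    Integrable ((Set.Icc (-r) r).indicator (fun _ => 1 / (2 * r))) :=
  (integrable_indicator_iff measurableSet_Icc).2 (integrableOn_const measure_Icc_lt_top.ne)

/-- Moving positive mass to a strictly wider interval strictly decreases the divergence. -/
theorem KLdiv_transfer_lt (hℓ : ∀ k ∈ Finset.Icc 1 A, 0 < ℓ k)
    (hle : ∀ k ∈ Finset.Icc 1 A, ℓ k ≤ ℓ A) (hπ : ∀ k ∈ Finset.Icc 1 A, 0 ≤ π k)
    {i j : ℕ} (hi : i ∈ Finset.Icc 1 A) (hj : j ∈ Finset.Icc 1 A) (hij : ℓ j < ℓ i) {m : ℝ}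
    (hm : 0 < m)
    (hπ' : ∀ k ∈ Finset.Icc 1 A, 0 ≤ (π + Pi.single i m - Pi.single j m : ℕ → ℝ) k) :
    KLdiv A ℓ (π + Pi.single i m - Pi.single j m : ℕ → ℝ) < KLdiv A ℓ π := by
  have hne : i ≠ j := fun h => hij.ne (by rw [h])
  have hpi : 0 < (π + Pi.single i m - Pi.single j m : ℕ → ℝ) i := by
    have := hπ i hi
    simp only [Pi.sub_apply, Pi.add_apply, Pi.single_eq_same, Pi.single_eq_of_ne hne]
    linarith
  have htr := uMix_transfer (ℓ := ℓ) (π := π) hi hj m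
  set ρ : ℕ → ℝ := π + Pi.single i m - Pi.single j m
  have hli := hℓ i hi
  have hlj := hℓ j hj
  have hK : 0 < 2 * ℓ A := by linarith [hle i hi]
  set K := 2 * ℓ A
  set C := Real.log (uMix A ℓ ρ (ℓ j) * K) + 1
  set wi := (Set.Icc (-ℓ i) (ℓ i)).indicator fun _ => 1 / (2 * ℓ i) with hwi
  set wj := (Set.Icc (-ℓ j) (ℓ j)).indicator fun _ => 1 / (2 * ℓ j) with hwj
  have hcpos : 0 < uMix A ℓ ρ (ℓ j) := uMix_pos hℓ hπ' hi hpi ⟨by linarith, hij.le⟩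
  have hin : ∀ x ∈ Set.Icc (-ℓ i) (ℓ i), 0 < uMix A ℓ π x * Real.log (uMix A ℓ π x * K) -
      uMix A ℓ ρ x * Real.log (uMix A ℓ ρ x * K) - m * (wj x - wi x) * C := by
    intro x hx
    have hpos := uMix_pos hℓ hπ' hi hpi hx
    have hdiff : uMix A ℓ π x - uMix A ℓ ρ x = m * (wj x - wi x) := by
      rw [htr x]
      ring
    have hxi : wi x = 1 / (2 * ℓ i) := Set.indicator_of_mem hx _
    have hcross : m * (wj x - wi x) ≠ 0 ∧
        m * (wj x - wi x) * C ≤ m * (wj x - wi x) * (Real.log (uMix A ℓ ρ x * K) + 1) := by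
      by_cases hxj : x ∈ Set.Icc (-ℓ j) (ℓ j)
      · have hw : 0 < wj x - wi x := by
          rw [hxi, hwj, Set.indicator_of_mem hxj, sub_pos]
          exact one_div_lt_one_div_of_lt (by linarith) (by linarith)
        have hmw := mul_pos hm hw
        have hu : uMix A ℓ ρ (ℓ j) ≤ uMix A ℓ ρ x :=
          uMix_anti hℓ hπ' ((abs_le.2 hxj).trans (le_abs_self _))
        refine ⟨hmw.ne', mul_le_mul_of_nonneg_left (add_le_add_left ?_ 1) hmw.le⟩
        exact Real.log_le_log (mul_pos hcpos hK) (mul_le_mul_of_nonneg_right hu hK.le)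
      · have hw : wj x - wi x < 0 := by
          rw [hxi, hwj, Set.indicator_of_notMem hxj, zero_sub, neg_lt_zero]
          positivity
        have hmw := mul_neg_of_pos_of_neg hm hw
        have hu : uMix A ℓ ρ x ≤ uMix A ℓ ρ (ℓ j) := by
          refine uMix_anti hℓ hπ' ?_
          rw [abs_of_pos hlj]
          exact (not_le.1 fun h => hxj (abs_le.1 h)).le
        refine ⟨hmw.ne, mul_le_mul_of_nonpos_left (add_le_add_left ?_ 1) hmw.le⟩
        exact Real.log_le_log (mul_pos hpos hK) (mul_le_mul_of_nonneg_right hu hK.le)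
    have ht := mul_log_mul_tangent_lt hpos (uMix_nonneg hℓ hπ x) hK
      (sub_ne_zero.1 (hdiff ▸ hcross.1))
    rw [hdiff] at ht
    linarith [hcross.2]
  have hout : ∀ x ∉ Set.Icc (-ℓ i) (ℓ i), uMix A ℓ π x * Real.log (uMix A ℓ π x * K) -
      uMix A ℓ ρ x * Real.log (uMix A ℓ ρ x * K) - m * (wj x - wi x) * C = 0 := by
    intro x hx
    have hxi : wi x = 0 := Set.indicator_of_notMem hx _
    have hxj : wj x = 0 := Set.indicator_of_notMem
      (fun h => hx (Set.Icc_subset_Icc (neg_le_neg hij.le) hij.le h)) _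
    rw [htr x, hxi, hxj]
    simp
  have hI (p : ℕ → ℝ) (hp : ∀ k ∈ Finset.Icc 1 A, 0 ≤ p k) :
      Integrable fun x => uMix A ℓ p x * Real.log (uMix A ℓ p x * K) :=
    integrable_comp_uMix hℓ hle hp (continuous_mul_log_mul K hK) (by simp)
  have hIw : Integrable fun x => m * (wj x - wi x) * C :=
    (((integrable_uniform _).sub (integrable_uniform _)).const_mul m).mul_const C
  have hw0 : ∫ x, m * (wj x - wi x) * C = 0 := by
    rw [integral_mul_const, integral_const_mul,
      integral_sub (integrable_uniform _) (integrable_uniform _), integral_uniform hlj,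
      integral_uniform hli]
    simp
  have hIs : Integrable fun x => uMix A ℓ π x * Real.log (uMix A ℓ π x * K) -
      uMix A ℓ ρ x * Real.log (uMix A ℓ ρ x * K) := (hI π hπ).sub (hI ρ hπ')
  have hpos : 0 < ∫ x, (uMix A ℓ π x * Real.log (uMix A ℓ π x * K) -
      uMix A ℓ ρ x * Real.log (uMix A ℓ ρ x * K) - m * (wj x - wi x) * C) := by
    refine (integral_pos_iff_support_of_nonneg (fun x => ?_) (hIs.sub hIw)).2 ?_
    · by_cases hx : x ∈ Set.Icc (-ℓ i) (ℓ i)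
      · exact (hin x hx).le
      · exact (hout x hx).ge
    · refine lt_of_lt_of_le ?_ (measure_mono fun x hx => (hin x hx).ne')
      rw [Real.volume_Icc, ENNReal.ofReal_pos]
      linarith
  rw [integral_sub hIs hIw, hw0, sub_zero, integral_sub (hI π hπ) (hI ρ hπ')] at hpos
  rw [KLdiv_eq hle, KLdiv_eq hle]
  linarith

end Density

/-- a maximizer of the objective puts zero mass on any Pareto
dominated action. -/
theorem maximizer_zero_on_pareto_dominated (A : ℕ) (hA : 1 ≤ A) (ℓ : ℕ → ℝ)
    (hℓ0 : ℓ 0 = 0) (hℓ1 : 0 < ℓ 1)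
    (hmono : ∀ n, 1 ≤ n → n < A → ℓ n < ℓ (n + 1))
    (κ : ℝ) (hκ : 0 < κ) (q : ℕ → ℝ)
    (j : ℕ) (hj : j ∈ Finset.Icc 1 A) (hdom : ParetoDominated A ℓ q j)
    (π : ℕ → ℝ) (hπ : IsPolicy A π)
    (hmax : ∀ π', IsPolicy A π' → objective A ℓ q κ π' ≤ objective A ℓ q κ π) :
    π j = 0 := by
  have hmon : ∀ n, 1 ≤ n → ∀ k, n ≤ k → k ≤ A → ℓ n ≤ ℓ k := by
    intro n hn k hk
    induction k, hk using Nat.le_induction with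
    | base => exact fun _ => le_rfl
    | succ k hk ih =>
      exact fun hkA => (ih (by omega)).trans (hmono k (hn.trans hk) (by omega)).le
  have hℓ : ∀ k ∈ Finset.Icc 1 A, 0 < ℓ k := fun k hk =>
    hℓ1.trans_le (hmon 1 le_rfl k (Finset.mem_Icc.1 hk).1 (Finset.mem_Icc.1 hk).2)
  have hle : ∀ k ∈ Finset.Icc 1 A, ℓ k ≤ ℓ A := fun k hk =>
    hmon k (Finset.mem_Icc.1 hk).1 A (Finset.mem_Icc.1 hk).2 le_rfl
  obtain ⟨i, hi, hq, hij⟩ := hdom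
  by_contra hne
  have hm : 0 < π j := lt_of_le_of_ne (hπ.1 j hj) (Ne.symm hne)
  have hsum := sum_transfer (π := π) hi hj (π j)
  have hπ' : ∀ k ∈ Finset.Icc 1 A,
      0 ≤ (π + Pi.single i (π j) - Pi.single j (π j) : ℕ → ℝ) k := by
    intro k hk
    have h1 : 0 ≤ (Pi.single i (π j) : ℕ → ℝ) k := by
      by_cases h : k = i
      · subst h
        simpa using hm.le
      · simp [h]
    simp only [Pi.sub_apply, Pi.add_apply]
    by_cases h : k = j
    · subst h
      simpa using h1
    · simpa [h] using add_nonneg (hπ.1 k hk) h1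
  have hpol : IsPolicy A (π + Pi.single i (π j) - Pi.single j (π j) : ℕ → ℝ) := by
    refine ⟨hπ', ?_⟩
    have h := hsum fun _ => 1
    simp only [mul_one, sub_self, mul_zero, add_zero] at h
    exact h.trans hπ.2
  have hD := mul_lt_mul_of_pos_left (KLdiv_transfer_lt hℓ hle hπ.1 hi hj hij hm hπ') hκ
  have hf := hmax _ hpol
  have hs : ∑ k ∈ Finset.Icc 1 A,
      (π + Pi.single i (π j) - Pi.single j (π j) : ℕ → ℝ) k * q k =
      ∑ k ∈ Finset.Icc 1 A, π k * q k + π j * (q i - q j) := hsum q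
  simp only [objective, hs] at hf
  linarith [mul_nonneg hm.le (sub_nonneg.2 hq)]
end

section
/- Regard p_j and hence π* as functions of κ > 0 (the Pareto optimal set E and the ordering σ do not depend on κ). Then lim_{κ→0+} π*_κ(σ(1)) = 1 and lim_{κ→0+} π*_κ(a) = 0 for every action a ≠ σ(1); moreover q_{σ(1)} = max_{a ∈ E} q_a, so as κ → 0+ the policy π*_κ converges to the greedy policy concentrated on the Pareto optimal action with maximal q-value. -/
open MeasureTheory

-- The set `E` of Pareto optimal actions in `{1, …, A}`.
open Classical in
noncomputable def paretoSet (A : ℕ) (ℓ q : ℕ → ℝ) : Finset ℕ :=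
  (Finset.Icc 1 A).filter (fun a => ParetoOptimal A ℓ q a)

/-- `ℓ_{σ(j)}`, with the convention `ℓ_{σ(0)} = 0`. -/
noncomputable def sigL (ℓ : ℕ → ℝ) (σ : ℕ → ℕ) (j : ℕ) : ℝ :=
  if j = 0 then 0 else ℓ (σ j)

/-- `ℓ_{σ(j)} q_{σ(j)}`, with the convention `ℓ_{σ(0)} q_{σ(0)} = 0`. -/
noncomputable def sigLQ (ℓ q : ℕ → ℝ) (σ : ℕ → ℕ) (j : ℕ) : ℝ :=
  if j = 0 then 0 else ℓ (σ j) * q (σ j)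

/-- `p_j = exp((ℓ_{σ(j)} q_{σ(j)} − ℓ_{σ(j−1)} q_{σ(j−1)}) / (κ (ℓ_{σ(j)} − ℓ_{σ(j−1)})))`
for `1 ≤ j ≤ m`, together with the convention `p_j = 0` for `j` outside `{1, …, m}`
(in particular `p_{m+1} = 0`). -/
noncomputable def pFun (ℓ q : ℕ → ℝ) (κ : ℝ) (σ : ℕ → ℕ) (m : ℕ) (j : ℕ) : ℝ :=
  if 1 ≤ j ∧ j ≤ m then
    Real.exp ((sigLQ ℓ q σ j - sigLQ ℓ q σ (j - 1)) /
      (κ * (sigL ℓ σ j - sigL ℓ σ (j - 1))))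
  else 0

/-- The normalizing constant `Σ_{j'=1}^{m} (ℓ_{σ(j')} − ℓ_{σ(j'−1)}) p_{j'}`. -/
noncomputable def Zpart (ℓ q : ℕ → ℝ) (κ : ℝ) (σ : ℕ → ℕ) (m : ℕ) : ℝ :=
  ∑ j ∈ Finset.Icc 1 m, (sigL ℓ σ j - sigL ℓ σ (j - 1)) * pFun ℓ q κ σ m j

open Filter Topology

/-- `exp (c / κ) → 0` as `κ → 0⁺` when `c < 0`. -/
theorem tendsto_exp_div_nhdsGT_zero {c : ℝ} (hc : c < 0) :
    Tendsto (fun κ : ℝ => Real.exp (c / κ)) (𝓝[>] 0) (𝓝 0) := by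
  refine Real.tendsto_exp_atBot.comp ?_
  exact tendsto_inv_nhdsGT_zero.const_mul_atTop_of_neg hc

theorem pos_of_forall_lt_succ {A : ℕ} {ℓ : ℕ → ℝ} (hℓ1 : 0 < ℓ 1)
    (hmono : ∀ n, 1 ≤ n → n < A → ℓ n < ℓ (n + 1)) :
    ∀ n, 1 ≤ n → n ≤ A → 0 < ℓ n := by
  intro n hn
  induction n, hn using Nat.le_induction with
  | base => exact fun _ => hℓ1
  | succ k hk ih => exact fun h => (ih (by omega)).trans (hmono k hk h)

theorem mem_Icc_of_mem_paretoSet {A : ℕ} {ℓ q : ℕ → ℝ} {a : ℕ} (ha : a ∈ paretoSet A ℓ q) :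
    a ∈ Finset.Icc 1 A := by
  simp only [paretoSet, Finset.mem_filter] at ha
  exact ha.1

theorem lt_of_mem_paretoSet {A : ℕ} {ℓ q : ℕ → ℝ} {a b : ℕ} (ha : a ∈ paretoSet A ℓ q)
    (hb : b ∈ paretoSet A ℓ q) (hab : ℓ a < ℓ b) : q b < q a := by
  simp only [paretoSet, Finset.mem_filter] at ha hb
  by_contra! h
  exact ha.2.1 ⟨b, hb.1, h, hab⟩

/-- If the `q`-values decrease along `σ`, the ratio `p_j / p_1` vanishes as `κ → 0⁺` for `j ≥ 2`. -/
theorem tendsto_pFun_div_pFun_one {ℓ q : ℕ → ℝ} {σ : ℕ → ℕ} {m : ℕ} (hm : 1 ≤ m)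
    (hpos : ∀ j ∈ Finset.Icc 1 m, 0 < ℓ (σ j))
    (hσmono : ∀ i ∈ Finset.Icc 1 m, ∀ j ∈ Finset.Icc 1 m, i < j → ℓ (σ i) < ℓ (σ j))
    (hq : ∀ i ∈ Finset.Icc 1 m, ∀ j ∈ Finset.Icc 1 m, i < j → q (σ j) < q (σ i))
    {j : ℕ} (hj : 2 ≤ j) :
    Tendsto (fun κ => pFun ℓ q κ σ m j / pFun ℓ q κ σ m 1) (𝓝[>] 0) (𝓝 0) := by
  by_cases hjm : j ≤ m
  · have h1 : 1 ∈ Finset.Icc 1 m := Finset.mem_Icc.2 ⟨le_rfl, hm⟩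
    have hjI : j ∈ Finset.Icc 1 m := Finset.mem_Icc.2 ⟨by omega, hjm⟩
    have hiI : j - 1 ∈ Finset.Icc 1 m := Finset.mem_Icc.2 ⟨by omega, by omega⟩
    have hl1 := hpos 1 h1
    have hlj := hpos j hjI
    have hlt := hσmono (j - 1) hiI j hjI (by omega)
    have hqlt := hq (j - 1) hiI j hjI (by omega)
    have hqle : q (σ (j - 1)) ≤ q (σ 1) := by
      rcases eq_or_lt_of_le (show 1 ≤ j - 1 by omega) with h | h
      · rw [← h]
      · exact (hq 1 h1 (j - 1) hiI h).le
    have hslope : (ℓ (σ j) * q (σ j) - ℓ (σ (j - 1)) * q (σ (j - 1))) /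
        (ℓ (σ j) - ℓ (σ (j - 1))) - q (σ 1) < 0 := by
      rw [sub_neg, div_lt_iff₀ (sub_pos.2 hlt)]
      nlinarith [mul_lt_mul_of_pos_left hqlt hlj,
        mul_le_mul_of_nonneg_right hqle (sub_pos.2 hlt).le]
    refine (tendsto_exp_div_nhdsGT_zero hslope).congr' ?_
    filter_upwards [self_mem_nhdsWithin] with κ hκ
    have hκ' : κ ≠ 0 := ne_of_gt hκ
    have hd : ℓ (σ j) - ℓ (σ (j - 1)) ≠ 0 := (sub_pos.2 hlt).ne'
    simp only [pFun, sigL, sigLQ, hjm, hm, show 1 ≤ j by omega, show j ≠ 0 by omega,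
      show j - 1 ≠ 0 by omega, and_self, if_true, if_false, le_refl, one_ne_zero, tsub_self,
      sub_zero]
    rw [← Real.exp_sub]
    congr 1
    field_simp
  · simp [pFun, hjm]

/-- as `κ → 0⁺`, the policy `π*_κ` converges to the greedy policy
concentrated on `σ(1)`, the Pareto optimal action with maximal `q`-value. -/
theorem pistar_tendsto_greedy (A : ℕ) (hA : 1 ≤ A) (ℓ : ℕ → ℝ)
    (hℓ0 : ℓ 0 = 0) (hℓ1 : 0 < ℓ 1)
    (hmono : ∀ n, 1 ≤ n → n < A → ℓ n < ℓ (n + 1))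
    (q : ℕ → ℝ)
    (m : ℕ) (hm : m = (paretoSet A ℓ q).card)
    (hE : (paretoSet A ℓ q).Nonempty)
    (σ : ℕ → ℕ)
    (hσim : (Finset.Icc 1 m).image σ = paretoSet A ℓ q)
    (hσmono : ∀ i ∈ Finset.Icc 1 m, ∀ j ∈ Finset.Icc 1 m, i < j → ℓ (σ i) < ℓ (σ j))
    (πstar : ℝ → ℕ → ℝ)
    (hπ1 : ∀ κ : ℝ, 0 < κ → ∀ j ∈ Finset.Icc 1 m,
      πstar κ (σ j) =
        ℓ (σ j) * (pFun ℓ q κ σ m j - pFun ℓ q κ σ m (j + 1)) / Zpart ℓ q κ σ m)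
    (hπ2 : ∀ κ : ℝ, 0 < κ → ∀ a, a ∉ paretoSet A ℓ q → πstar κ a = 0) :
    Filter.Tendsto (fun κ => πstar κ (σ 1)) (nhdsWithin 0 (Set.Ioi 0)) (nhds 1) ∧
    (∀ a ∈ Finset.Icc 1 A, a ≠ σ 1 →
      Filter.Tendsto (fun κ => πstar κ a) (nhdsWithin 0 (Set.Ioi 0)) (nhds 0)) ∧
    (∀ a ∈ paretoSet A ℓ q, q a ≤ q (σ 1)) := by
  have hm1 : 1 ≤ m := hm ▸ hE.card_pos
  have h1 : 1 ∈ Finset.Icc 1 m := Finset.mem_Icc.2 ⟨le_rfl, hm1⟩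
  have hmem : ∀ j ∈ Finset.Icc 1 m, σ j ∈ paretoSet A ℓ q := fun j hj =>
    hσim ▸ Finset.mem_image_of_mem σ hj
  have hpos : ∀ j ∈ Finset.Icc 1 m, 0 < ℓ (σ j) := by
    intro j hj
    have h := Finset.mem_Icc.1 (mem_Icc_of_mem_paretoSet (hmem j hj))
    exact pos_of_forall_lt_succ hℓ1 hmono _ h.1 h.2
  have hq : ∀ i ∈ Finset.Icc 1 m, ∀ j ∈ Finset.Icc 1 m, i < j → q (σ j) < q (σ i) :=
    fun i hi j hj hij => lt_of_mem_paretoSet (hmem i hi) (hmem j hj) (hσmono i hi j hj hij)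
  have hp1 : ∀ κ, pFun ℓ q κ σ m 1 ≠ 0 := fun κ => by simp [pFun, hm1]
  have hratio1 : Tendsto (fun κ => pFun ℓ q κ σ m 1 / pFun ℓ q κ σ m 1) (𝓝[>] 0) (𝓝 1) := by
    simp only [div_self (hp1 _), tendsto_const_nhds]
  have hratio : ∀ j, 2 ≤ j →
      Tendsto (fun κ => pFun ℓ q κ σ m j / pFun ℓ q κ σ m 1) (𝓝[>] 0) (𝓝 0) := fun j hj =>
    tendsto_pFun_div_pFun_one hm1 hpos hσmono hq hj
  have hZ : Tendsto (fun κ => Zpart ℓ q κ σ m / pFun ℓ q κ σ m 1) (𝓝[>] 0) (𝓝 (ℓ (σ 1))) := by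
    have hsum : Tendsto (fun κ => ∑ j ∈ Finset.Icc 1 m, (sigL ℓ σ j - sigL ℓ σ (j - 1)) *
        (pFun ℓ q κ σ m j / pFun ℓ q κ σ m 1)) (𝓝[>] 0)
        (𝓝 (∑ j ∈ Finset.Icc 1 m, (sigL ℓ σ j - sigL ℓ σ (j - 1)) *
          (if j = 1 then 1 else 0))) := by
      refine tendsto_finsetSum _ fun j hj => Tendsto.const_mul _ ?_
      by_cases h : j = 1
      · simpa [h] using hratio1
      · simpa [h] using hratio j (by have := Finset.mem_Icc.1 hj; omega)
    simpa [Zpart, Finset.sum_div, mul_div_assoc, sigL, hm1] using hsum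
  have hl1 : ℓ (σ 1) ≠ 0 := (hpos 1 h1).ne'
  have hlim : ∀ j ∈ Finset.Icc 1 m, ∀ c : ℝ,
      Tendsto (fun κ => pFun ℓ q κ σ m j / pFun ℓ q κ σ m 1) (𝓝[>] 0) (𝓝 c) →
      Tendsto (fun κ => πstar κ (σ j)) (𝓝[>] 0) (𝓝 (ℓ (σ j) * (c - 0) / ℓ (σ 1))) := by
    intro j hj c hc
    have hj1 := hratio (j + 1) (by have := Finset.mem_Icc.1 hj; omega)
    refine (((hc.sub hj1).const_mul (ℓ (σ j))).div hZ hl1).congr' ?_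
    filter_upwards [self_mem_nhdsWithin] with κ hκ
    rw [hπ1 κ hκ j hj, Pi.div_apply, ← sub_div, ← mul_div_assoc]
    exact div_div_div_cancel_right₀ (hp1 κ) _ _
  refine ⟨?_, fun a _ hne => ?_, fun a ha => ?_⟩
  · simpa [hl1] using hlim 1 h1 1 hratio1
  · by_cases ha : a ∈ paretoSet A ℓ q
    · obtain ⟨j, hj, rfl⟩ := Finset.mem_image.1 (hσim ▸ ha)
      have hj1 : j ≠ 1 := fun h => hne (h ▸ rfl)
      simpa using hlim j hj 0 (hratio j (by have := Finset.mem_Icc.1 hj; omega))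
    · refine tendsto_const_nhds.congr' ?_
      filter_upwards [self_mem_nhdsWithin] with κ hκ
      exact (hπ2 κ hκ a ha).symm
  · obtain ⟨j, hj, rfl⟩ := Finset.mem_image.1 (hσim ▸ ha)
    rcases eq_or_lt_of_le (Finset.mem_Icc.1 hj).1 with h | h
    · rw [← h]
    · exact (hq 1 h1 j hj h).le
end
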